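/- Let E be a real inner product space, U ⊆ E an open convex set, and f : E → ℝ twice continuously differentiable on U with the operator norm of its second derivative bounded by C ≥ 0 at every point of U. Let ℓ : ℝ → ℝ be Lipschitz with constant L. Let θ_1, …, θ_M ∈ U, θ_WA = (1/M) ∑_{m=1}^M θ_m, and Δ = max_{1 ≤ m ≤ M} ‖θ_m − θ_WA‖. Then |ℓ(f(θ_WA)) − ℓ((1/M) ∑_{m=1}^M f(θ_m))| ≤ (L·C/2) Δ², i.e., the loss of the weight-averaged model equals the loss of the prediction-averaged ensemble up to an error of order Δ². -/

import Mathlib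

open Set in
/-- A map with `C`-Lipschitz derivative (at `x`) on a convex set deviates from its first-order
Taylor polynomial at `x` by at most `C / 2 * ‖y - x‖ ^ 2`. -/
theorem Convex.norm_sub_sub_fderiv_le {E F : Type*} [NormedAddCommGroup E] [NormedSpace ℝ E]
    [NormedAddCommGroup F] [NormedSpace ℝ F] {s : Set E} (hs : Convex ℝ s) {f : E → F}
    {f' : E → E →L[ℝ] F} {C : ℝ} {x y : E} (hf : ∀ z ∈ s, HasFDerivAt f (f' z) z)
    (hf' : ∀ z ∈ s, ‖f' z - f' x‖ ≤ C * ‖z - x‖) (hx : x ∈ s) (hy : y ∈ s) :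
    ‖f y - f x - f' x (y - x)‖ ≤ C / 2 * ‖y - x‖ ^ 2 := by
  set v := y - x with hv
  have hmem : ∀ t ∈ Icc (0 : ℝ) 1, x + t • v ∈ s := fun t ht =>
    hs.add_smul_sub_mem hx hy ht
  have hderiv : ∀ t ∈ Icc (0 : ℝ) 1,
      HasDerivAt (fun t : ℝ => f (x + t • v) - f x - t • f' x v)
        ((f' (x + t • v) - f' x) v) t := by
    intro t ht
    have hline : HasDerivAt (fun t : ℝ => x + t • v) v t := by
      simpa using ((hasDerivAt_id t).smul_const v).const_add x
    have hlin : HasDerivAt (fun t : ℝ => t • f' x v) (f' x v) t := by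
      simpa using (hasDerivAt_id t).smul_const (f' x v)
    exact (((hf _ (hmem t ht)).comp_hasDerivAt t hline).sub_const (f x)).sub hlin
  have hbound : ∀ t : ℝ, HasDerivAt (fun t : ℝ => C / 2 * ‖v‖ ^ 2 * t ^ 2)
      (C * t * ‖v‖ ^ 2) t := by
    intro t
    refine ((hasDerivAt_pow 2 t).const_mul (C / 2 * ‖v‖ ^ 2)).congr_deriv ?_
    push_cast
    ring
  have key := image_norm_le_of_norm_deriv_right_le_deriv_boundary
    (fun t ht => (hderiv t ht).continuousAt.continuousWithinAt)
    (fun t ht => (hderiv t (Ico_subset_Icc_self ht)).hasDerivWithinAt)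
    (by simp) hbound
    (fun t ht => by
      have ht' := Ico_subset_Icc_self ht
      have h := hf' _ (hmem t ht')
      rw [add_sub_cancel_left, norm_smul, Real.norm_of_nonneg ht.1] at h
      calc ‖(f' (x + t • v) - f' x) v‖ ≤ C * (t * ‖v‖) * ‖v‖ :=
            ContinuousLinearMap.le_of_opNorm_le _ h v
        _ = C * t * ‖v‖ ^ 2 := by ring)
    (right_mem_Icc.mpr zero_le_one)
  simpa [hv] using key

/-- Second-order Taylor bound on an open convex set, from a bound on the second derivative. -/
theorem ContDiffOn.norm_sub_sub_fderivWithin_le {E F : Type*} [NormedAddCommGroup E]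
    [NormedSpace ℝ E] [NormedAddCommGroup F] [NormedSpace ℝ F] {s : Set E} (hso : IsOpen s)
    (hs : Convex ℝ s) {f : E → F} {C : ℝ} (hf : ContDiffOn ℝ 2 f s)
    (hf'' : ∀ x ∈ s, ‖iteratedFDerivWithin ℝ 2 f s x‖ ≤ C) {x y : E} (hx : x ∈ s) (hy : y ∈ s) :
    ‖f y - f x - fderivWithin ℝ f s x (y - x)‖ ≤ C / 2 * ‖y - x‖ ^ 2 := by
  have hu : UniqueDiffOn ℝ s := hso.uniqueDiffOn
  refine hs.norm_sub_sub_fderiv_le (f' := fderivWithin ℝ f s) (fun z hz => ?_)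
    (fun z hz => ?_) hx hy
  · exact ((hf.differentiableOn two_ne_zero z hz).hasFDerivWithinAt).hasFDerivAt
      (hso.mem_nhds hz)
  · have hD : ContDiffOn ℝ 1 (fderivWithin ℝ f s) s :=
      hf.fderivWithin hu (by norm_num [one_add_one_eq_two])
    refine hs.norm_image_sub_le_of_norm_fderivWithin_le (hD.differentiableOn one_ne_zero)
      (fun w hw => ?_) hx hz
    rw [← norm_iteratedFDerivWithin_one _ (hu w hw),
      norm_iteratedFDerivWithin_fderivWithin hu hw]
    exact hf'' w hw

/-- Quantitative loss approximation (paper's Lemma 1, loss part):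
the loss of the weight-averaged model equals the loss of the
prediction-averaged ensemble up to an error of order `Δ²`. -/
theorem wa_loss_approximates_ens_loss {E : Type*} [NormedAddCommGroup E]
    [InnerProductSpace ℝ E]
    (U : Set E) (hUopen : IsOpen U) (hUconv : Convex ℝ U)
    (f : E → ℝ) (C : ℝ) (hC : 0 ≤ C)
    (hf : ContDiffOn ℝ 2 f U)
    (hf'' : ∀ x ∈ U, ‖iteratedFDerivWithin ℝ 2 f U x‖ ≤ C)
    (ℓ : ℝ → ℝ) (L : ℝ) (hL : 0 ≤ L)
    (hℓ : ∀ a b : ℝ, |ℓ a - ℓ b| ≤ L * |a - b|)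
    (M : ℕ) (hM : 1 ≤ M)
    (θ : Fin M → E) (hθ : ∀ m, θ m ∈ U)
    (θWA : E) (hθWA : θWA = (M : ℝ)⁻¹ • ∑ m, θ m)
    (Δ : ℝ) (hΔ : Δ = ⨆ m, ‖θ m - θWA‖) :
    |ℓ (f θWA) - ℓ ((M : ℝ)⁻¹ * ∑ m, f (θ m))| ≤ L * C / 2 * Δ ^ 2 := by
  have hM0 : (M : ℝ) ≠ 0 := by positivity
  have hWA : θWA ∈ U := by
    rw [hθWA, Finset.smul_sum]
    exact hUconv.sum_mem (fun _ _ => by positivity) (by simp [hM0]) (fun m _ => hθ m)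
  have hsum : ∑ m, (θ m - θWA) = 0 := by
    rw [Finset.sum_sub_distrib, hθWA]
    simp [← Nat.cast_smul_eq_nsmul ℝ, smul_smul, hM0]
  have hle : ∀ m, ‖θ m - θWA‖ ≤ Δ := fun m =>
    hΔ ▸ le_ciSup (f := fun m => ‖θ m - θWA‖) (Set.finite_range _).bddAbove m
  set D := fderivWithin ℝ f U θWA
  have hterm : ∀ m, ‖f (θ m) - f θWA - D (θ m - θWA)‖ ≤ C / 2 * Δ ^ 2 := fun m =>
    (hf.norm_sub_sub_fderivWithin_le hUopen hUconv hf'' hWA (hθ m)).trans <| by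
      gcongr
      exact hle m
  have hrem : (M : ℝ)⁻¹ * ∑ m, f (θ m) - f θWA
      = (M : ℝ)⁻¹ * ∑ m, (f (θ m) - f θWA - D (θ m - θWA)) := by
    rw [Finset.sum_sub_distrib, ← map_sum, hsum, map_zero, Finset.sum_sub_distrib]
    simp
    field_simp
  have hens : |f θWA - (M : ℝ)⁻¹ * ∑ m, f (θ m)| ≤ C / 2 * Δ ^ 2 := by
    rw [abs_sub_comm, hrem, abs_mul, abs_of_nonneg (by positivity)]
    calc (M : ℝ)⁻¹ * |∑ m, (f (θ m) - f θWA - D (θ m - θWA))|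
        ≤ (M : ℝ)⁻¹ * (M * (C / 2 * Δ ^ 2)) := by
          gcongr
          simpa using norm_sum_le_of_le Finset.univ (fun m _ => hterm m)
      _ = C / 2 * Δ ^ 2 := inv_mul_cancel_left₀ hM0 _
  calc |ℓ (f θWA) - ℓ ((M : ℝ)⁻¹ * ∑ m, f (θ m))|
      ≤ L * |f θWA - (M : ℝ)⁻¹ * ∑ m, f (θ m)| := hℓ _ _
    _ ≤ L * (C / 2 * Δ ^ 2) := by gcongr
    _ = L * C / 2 * Δ ^ 2 := by ring
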